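/- In the relative entropy case, for every θ₂ in dom Λ := {θ₂ : Λ(θ₂) < +∞}, the infimum defining G(θ₂) is attained at θ₁ = 1 − Λ(θ₂) and G(θ₂) = Λ(θ₂), where Λ(θ₂) := log ∫_Ω e^{θ₂X} dμ. Consequently, for every k ∈ (0, k_max), V(k) = max_{θ₂<0} (k + Λ(θ₂))/θ₂, and the worst case localiser is q̂_k(r) = exp(θ₂X(r) − Λ(θ₂)) with θ₂ < 0 attaining this maximum; in particular q̂_k is a density. -/

import Mathlib

open MeasureTheory Filter Set Topology
open scoped ENNReal

noncomputable section

variable {Ω : Type*} [MeasurableSpace Ω]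

/-- The positive part of an extended real number, as a member of `ℝ≥0∞`. -/
def ePos (x : EReal) : ℝ≥0∞ := if x = ⊤ then ⊤ else ENNReal.ofReal x.toReal

/-- The (signed) integral of an extended-real-valued function: the integral of its
positive part minus the integral of its negative part. -/
def eInt (μ : Measure Ω) (f : Ω → EReal) : EReal :=
  ((∫⁻ r, ePos (f r) ∂μ : ℝ≥0∞) : EReal) - ((∫⁻ r, ePos (-(f r)) ∂μ : ℝ≥0∞) : EReal)

/-- `p` is a probability density with respect to `μ`. -/
def IsDensity (μ : Measure Ω) (p : Ω → ℝ) : Prop :=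
  Measurable p ∧ (∀ r, 0 ≤ p r) ∧ ∫⁻ r, ENNReal.ofReal (p r) ∂μ = 1

/-- `∫ p dμ` for a nonnegative function `p`. -/
def pInt (μ : Measure Ω) (p : Ω → ℝ) : ℝ≥0∞ := ∫⁻ r, ENNReal.ofReal (p r) ∂μ

/-- The convex integral functional `H(p) = ∫ β(r, p(r)) μ(dr)`. -/
def Hfun (μ : Measure Ω) (β : Ω → ℝ → EReal) (p : Ω → ℝ) : EReal :=
  eInt μ (fun r => β r (p r))

/-- The expected payoff `∫ X p dμ`, as an extended real number. -/
def xInt (μ : Measure Ω) (X p : Ω → ℝ) : EReal :=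
  eInt μ (fun r => ((X r * p r : ℝ) : EReal))

/-- The value function `F(b) = inf { H(p) : p density, ∫ X p dμ = b }`. -/
def Ffun (μ : Measure Ω) (β : Ω → ℝ → EReal) (X : Ω → ℝ) (b : ℝ) : EReal :=
  ⨅ p : {p : Ω → ℝ // IsDensity μ p ∧ xInt μ X p = (b : EReal)}, Hfun μ β p.1

/-- The essential infimum `m` of `X`, as an extended real number. -/
def essInfX (μ : Measure Ω) (X : Ω → ℝ) : EReal := essInf (fun r => (X r : EReal)) μ

/-- The essential supremum `M` of `X`, as an extended real number. -/
def essSupX (μ : Measure Ω) (X : Ω → ℝ) : EReal := essSup (fun r => (X r : EReal)) μ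

/-- `k_max = lim_{b ↓ m} F(b)`; since `F` is nonincreasing on `(m, b₀)`, this limit
equals the supremum of `F` over `(m, b₀)`. -/
def kmax (μ : Measure Ω) (β : Ω → ℝ → EReal) (X : Ω → ℝ) (b₀ : ℝ) : EReal :=
  ⨆ b : {b : ℝ // essInfX μ X < (b : EReal) ∧ b < b₀}, Ffun μ β X b

/-- `V(k) = inf { ∫ X p dμ : p density, H(p) ≤ k }`. -/
def Vfun (μ : Measure Ω) (β : Ω → ℝ → EReal) (X : Ω → ℝ) (k : ℝ) : EReal :=
  ⨅ p : {p : Ω → ℝ // IsDensity μ p ∧ Hfun μ β p ≤ (k : EReal)}, xInt μ X p.1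

/-- `W(λ) = inf { ∫ X p dμ + λ H(p) : p density }`. -/
def Wfun (μ : Measure Ω) (β : Ω → ℝ → EReal) (X : Ω → ℝ) (lam : ℝ) : EReal :=
  ⨅ p : {p : Ω → ℝ // IsDensity μ p}, (xInt μ X p.1 + (lam : EReal) * Hfun μ β p.1)

/-- The convex conjugate `β*(r, τ) = sup_s (sτ − β(r,s))` of `β` in its second variable. -/
def conjβ (β : Ω → ℝ → EReal) (r : Ω) (τ : ℝ) : EReal :=
  ⨆ s : ℝ, (((s * τ : ℝ) : EReal) - β r s)

/-- `K(θ₁, θ₂) = ∫ β*(r, θ₁ + θ₂ X(r)) μ(dr)`. -/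
def Kfun (μ : Measure Ω) (β : Ω → ℝ → EReal) (X : Ω → ℝ) (θ₁ θ₂ : ℝ) : EReal :=
  eInt μ (fun r => conjβ β r (θ₁ + θ₂ * X r))

/-- `dom K = {(θ₁, θ₂) : K(θ₁,θ₂) < +∞}`. -/
def domK (μ : Measure Ω) (β : Ω → ℝ → EReal) (X : Ω → ℝ) : Set (ℝ × ℝ) :=
  {θ : ℝ × ℝ | Kfun μ β X θ.1 θ.2 < ⊤}

/-- `β'(r, +∞) = lim_{s ↑ ∞} β'(r,s)`; by monotonicity of the derivative of a convex
function this equals the supremum of `β'(r, ·)` over `(0, ∞)`. -/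
def derivTop (β' : Ω → ℝ → ℝ) (r : Ω) : EReal := ⨆ s : {s : ℝ // 0 < s}, (β' r s.1 : EReal)

/-- `β'(r, 0) = lim_{s ↓ 0} β'(r,s)`, the infimum of `β'(r, ·)` over `(0, ∞)`. -/
def derivZero (β' : Ω → ℝ → ℝ) (r : Ω) : EReal := ⨅ s : {s : ℝ // 0 < s}, (β' r s.1 : EReal)

/-- The parameter set `Θ`. -/
def ThetaSet (μ : Measure Ω) (β : Ω → ℝ → EReal) (β' : Ω → ℝ → ℝ) (X : Ω → ℝ) :
    Set (ℝ × ℝ) :=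
  {θ ∈ domK μ β X | ∀ᵐ r ∂μ, ((θ.1 + θ.2 * X r : ℝ) : EReal) < derivTop β' r}

/-- The generalised exponential family member `p_{θ₁,θ₂}(r) = (β*)'(r, θ₁ + θ₂ X(r))`,
where `ψ` denotes the derivative `(β*)'` of the conjugate in its second variable. -/
def pFam (ψ : Ω → ℝ → ℝ) (X : Ω → ℝ) (θ₁ θ₂ : ℝ) : Ω → ℝ :=
  fun r => ψ r (θ₁ + θ₂ * X r)

/-- `G(θ₂) = inf_{θ₁} [K(θ₁,θ₂) − θ₁]`. -/
def Gfun (μ : Measure Ω) (β : Ω → ℝ → EReal) (X : Ω → ℝ) (θ₂ : ℝ) : EReal :=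
  ⨅ θ₁ : ℝ, (Kfun μ β X θ₁ θ₂ - (θ₁ : EReal))

/-- `Θ₂ = dom G`, the projection of `dom K` to the `θ₂`-axis. -/
def Theta2 (μ : Measure Ω) (β : Ω → ℝ → EReal) (X : Ω → ℝ) : Set ℝ :=
  {θ₂ : ℝ | Gfun μ β X θ₂ < ⊤}

/-- The Bregman integrand `Δ_β(r, s, t)`; for `t = 0` it is defined as the limit `t ↓ 0`
(with `β'(r,0) = lim_{t↓0} β'(r,t)`), and if `β(r,0) = +∞` then `Δ_β(r,0,0) = 0` and
`Δ_β(r,s,0) = +∞` for `s > 0`. -/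
def bregmanInt (β : Ω → ℝ → EReal) (β' : Ω → ℝ → ℝ) (r : Ω) (s t : ℝ) : EReal :=
  if 0 < t then β r s - β r t - ((β' r t : EReal) * ((s - t : ℝ) : EReal))
  else if β r 0 = ⊤ then (if s = 0 then 0 else ⊤)
  else β r s - β r 0 - derivZero β' r * ((s : ℝ) : EReal)

/-- The (generalised) Bregman distance `B(p, q)`. -/
def Bdist (μ : Measure Ω) (β : Ω → ℝ → EReal) (β' : Ω → ℝ → ℝ) (p q : Ω → ℝ) : EReal :=
  eInt μ (fun r => bregmanInt β β' r (p r) (q r))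

/-- The standing assumptions of the framework: `μ` is σ-finite; `β` is a normal convex
integrand (measurable in `r`; equal to `+∞` for `s < 0`; finite, strictly convex and
differentiable with derivative `β'` on `(0,∞)`; right-continuous at `0`); `p₀` is a
density with finite expected payoff `b₀` satisfying `m < b₀ < M`; `H(p₀) = 0 ≤ H(p)`
for every density `p`; and `k_max > 0`. -/
structure Standing (μ : Measure Ω) (β : Ω → ℝ → EReal) (β' : Ω → ℝ → ℝ)
    (X : Ω → ℝ) (p₀ : Ω → ℝ) (b₀ : ℝ) : Prop where
  sigma : SigmaFinite μ
  betaMeas : ∀ s : ℝ, Measurable (fun r => β r s)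
  Xmeas : Measurable X
  betaNeg : ∀ r : Ω, ∀ s : ℝ, s < 0 → β r s = ⊤
  betaNeBot : ∀ r s, β r s ≠ ⊥
  betaFin : ∀ r : Ω, ∀ s : ℝ, 0 < s → β r s ≠ ⊤
  betaZero : ∀ r, Tendsto (fun s => β r s) (𝓝[>] (0:ℝ)) (𝓝 (β r 0))
  betaConv : ∀ r, StrictConvexOn ℝ (Ioi (0:ℝ)) (fun s => (β r s).toReal)
  betaDeriv : ∀ r : Ω, ∀ s ∈ Ioi (0:ℝ), HasDerivAt (fun t => (β r t).toReal) (β' r s) s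
  dens₀ : IsDensity μ p₀
  payoff₀ : xInt μ X p₀ = (b₀ : EReal)
  mlt : essInfX μ X < (b₀ : EReal)
  ltM : (b₀ : EReal) < essSupX μ X
  H₀ : Hfun μ β p₀ = 0
  Hnonneg : ∀ p, IsDensity μ p → 0 ≤ Hfun μ β p
  kmaxPos : 0 < kmax μ β X b₀

/-- The hypothesis that `ψ = (β*)'`: at every point `τ < β'(r,+∞)`, where the conjugate
`β*(r,·)` is finite and differentiable, `ψ r τ` is its derivative. -/
def IsConjDeriv (β : Ω → ℝ → EReal) (β' : Ω → ℝ → ℝ) (ψ : Ω → ℝ → ℝ) : Prop :=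
  ∀ r : Ω, ∀ τ : ℝ, ((τ : ℝ) : EReal) < derivTop β' r →
    HasDerivAt (fun t => (conjβ β r t).toReal) (ψ r τ) τ

/-- `(θ₁, θ₂)` with `θ₂ < 0` attains the double maximum
`max_{θ₂<0} max_{θ₁} (k + K(θ₁,θ₂) − θ₁)/θ₂` (whose value is `V(k)`); such a pair is a
parameter pair of the worst case localiser `q̂_k = p_{θ₁,θ₂}`. -/
def IsWCLParam (μ : Measure Ω) (β : Ω → ℝ → EReal) (X : Ω → ℝ) (k : ℝ) (θ₁ θ₂ : ℝ) : Prop :=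
  θ₂ < 0 ∧ ∀ θ₁' θ₂' : ℝ, θ₂' < 0 →
    ((k : EReal) + Kfun μ β X θ₁' θ₂' - (θ₁' : EReal)) / ((θ₂' : ℝ) : EReal) ≤
      ((k : EReal) + Kfun μ β X θ₁ θ₂ - (θ₁ : EReal)) / ((θ₂ : ℝ) : EReal)

/-- `p` is an (ε-γ)-almost worst case density for threshold `k`. -/
def AWCD (μ : Measure Ω) (β : Ω → ℝ → EReal) (X : Ω → ℝ) (k ε γ : ℝ) (p : Ω → ℝ) : Prop :=
  IsDensity μ p ∧ Hfun μ β p ≤ ((k + γ : ℝ) : EReal) ∧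
    xInt μ X p ≤ Vfun μ β X k + (ε : EReal)

/-- Convergence locally in measure. -/
def TendstoLocallyInMeasure (μ : Measure Ω) (p : ℕ → Ω → ℝ) (q : Ω → ℝ) : Prop :=
  ∀ C : Set Ω, MeasurableSet C → μ C < ⊤ → ∀ ε : ℝ, 0 < ε →
    Tendsto (fun n => μ {r ∈ C | ε < |p n r - q r|}) atTop (𝓝 0)

end
/-- The entropy integrand `β(r,s) = s log s` (with `β(r,0) = 0`, `β(r,s) = +∞` for
`s < 0`). -/
noncomputable def entIntegrand : ℝ → EReal :=
  fun s => if s < 0 then ⊤ else ((s * Real.log s : ℝ) : EReal)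

/-- The logarithmic moment generating function `Λ(θ₂) = log ∫ e^{θ₂ X} dμ`. -/
noncomputable def lmgf {Ω : Type*} [MeasurableSpace Ω] (μ : Measure Ω) (X : Ω → ℝ)
    (θ₂ : ℝ) : ℝ :=
  Real.log (∫⁻ r, ENNReal.ofReal (Real.exp (θ₂ * X r)) ∂μ).toReal

section EInt

variable {Ω : Type*} [MeasurableSpace Ω] {μ : Measure Ω} {f w : Ω → ℝ}

lemma ePos_coe (x : ℝ) : ePos (x : EReal) = ENNReal.ofReal x := by
  simp [ePos]

lemma eInt_coe (f : Ω → ℝ) :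
    eInt μ (fun r => (f r : EReal)) =
      ((∫⁻ r, ENNReal.ofReal (f r) ∂μ : ℝ≥0∞) : EReal) -
        ((∫⁻ r, ENNReal.ofReal (-f r) ∂μ : ℝ≥0∞) : EReal) := by
  simp only [eInt, ← EReal.coe_neg, ePos_coe]

lemma eInt_coe_of_integrable (hf : Integrable f μ) :
    eInt μ (fun r => (f r : EReal)) = ((∫ r, f r ∂μ : ℝ) : EReal) := by
  have h₁ : ∫⁻ r, ENNReal.ofReal (f r) ∂μ ≠ ⊤ := hf.lintegral_lt_top.ne
  have h₂ : ∫⁻ r, ENNReal.ofReal (-f r) ∂μ ≠ ⊤ := hf.neg.lintegral_lt_top.ne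
  rw [eInt_coe, integral_eq_lintegral_pos_part_sub_lintegral_neg_part hf, EReal.coe_sub,
    EReal.coe_ennreal_toReal h₁, EReal.coe_ennreal_toReal h₂]

lemma eInt_coe_of_nonneg (hf : ∀ r, 0 ≤ f r) :
    eInt μ (fun r => (f r : EReal)) = ((∫⁻ r, ENNReal.ofReal (f r) ∂μ : ℝ≥0∞) : EReal) := by
  have h : ∀ r, ENNReal.ofReal (-f r) = 0 := fun r =>
    ENNReal.ofReal_of_nonpos (neg_nonpos.2 (hf r))
  simp [eInt_coe, h]

lemma integrable_of_lintegral_ofReal_ne_top (hf : Measurable f)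
    (h₁ : ∫⁻ r, ENNReal.ofReal (f r) ∂μ ≠ ⊤) (h₂ : ∫⁻ r, ENNReal.ofReal (-f r) ∂μ ≠ ⊤) :
    Integrable f μ := by
  refine ⟨hf.aestronglyMeasurable, ?_⟩
  rw [hasFiniteIntegral_iff_norm]
  have h : ∀ r, ENNReal.ofReal ‖f r‖ = ENNReal.ofReal (f r) + ENNReal.ofReal (-f r) := by
    intro r
    rcases le_total 0 (f r) with h | h
    · rw [Real.norm_of_nonneg h, ENNReal.ofReal_of_nonpos (neg_nonpos.2 h), add_zero]
    · rw [Real.norm_of_nonpos h, ENNReal.ofReal_of_nonpos h, zero_add]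
  simp only [h]
  rw [lintegral_add_left hf.ennreal_ofReal]
  exact ENNReal.add_lt_top.2 ⟨h₁.lt_top, h₂.lt_top⟩

lemma integrable_of_eInt_coe_eq_coe (hf : Measurable f) {b : ℝ}
    (h : eInt μ (fun r => (f r : EReal)) = (b : EReal)) : Integrable f μ := by
  rw [eInt_coe] at h
  have h₂ : ∫⁻ r, ENNReal.ofReal (-f r) ∂μ ≠ ⊤ := by
    intro h₂
    rw [h₂, EReal.coe_ennreal_top, EReal.sub_top] at h
    exact EReal.bot_ne_coe b h
  refine integrable_of_lintegral_ofReal_ne_top hf (fun h₁ => ?_) h₂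
  rw [h₁, EReal.coe_ennreal_top, ← EReal.coe_ennreal_toReal h₂, EReal.top_sub_coe] at h
  exact EReal.top_ne_coe b h

lemma integrable_or_eInt_coe_eq_top (hf : Measurable f) (hw : Integrable w μ)
    (hwf : ∀ r, w r ≤ f r) :
    Integrable f μ ∨ eInt μ (fun r => (f r : EReal)) = ⊤ := by
  have h₂ : ∫⁻ r, ENNReal.ofReal (-f r) ∂μ ≠ ⊤ :=
    ((lintegral_mono fun r => ENNReal.ofReal_le_ofReal (neg_le_neg (hwf r))).trans_lt
      hw.neg.lintegral_lt_top).ne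
  by_cases h₁ : ∫⁻ r, ENNReal.ofReal (f r) ∂μ = ⊤
  · right
    rw [eInt_coe, h₁, EReal.coe_ennreal_top, ← EReal.coe_ennreal_toReal h₂, EReal.top_sub_coe]
  · exact Or.inl (integrable_of_lintegral_ofReal_ne_top hf h₁ h₂)

lemma coe_integral_le_eInt_coe (hf : Measurable f) (hw : Integrable w μ)
    (hwf : ∀ r, w r ≤ f r) :
    ((∫ r, w r ∂μ : ℝ) : EReal) ≤ eInt μ (fun r => (f r : EReal)) := by
  rcases integrable_or_eInt_coe_eq_top hf hw hwf with h | h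
  · rw [eInt_coe_of_integrable h]
    exact EReal.coe_le_coe_iff.2 (integral_mono hw h hwf)
  · rw [h]
    exact le_top

end EInt

lemma mul_le_mul_log_add_exp {s : ℝ} (hs : 0 ≤ s) (τ : ℝ) :
    s * τ ≤ s * Real.log s + Real.exp (τ - 1) := by
  rcases hs.eq_or_lt with rfl | hs
  · simpa using (Real.exp_pos _).le
  · have h := Real.add_one_le_exp (τ - 1 - Real.log s)
    rw [Real.exp_sub, Real.exp_log hs, le_div_iff₀ hs] at h
    linarith

lemma neg_one_le_mul_log {s : ℝ} (hs : 0 ≤ s) : -1 ≤ s * Real.log s := by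
  have h := mul_le_mul_log_add_exp hs 1
  simp only [sub_self, Real.exp_zero] at h
  linarith

lemma conjβ_entIntegrand {Ω : Type*} (r : Ω) (τ : ℝ) :
    conjβ (fun _ : Ω => entIntegrand) r τ = ((Real.exp (τ - 1) : ℝ) : EReal) := by
  refine le_antisymm (iSup_le fun s => ?_) ?_
  · rcases lt_or_ge s 0 with hs | hs
    · simp [entIntegrand, hs]
    · simp only [entIntegrand, hs.not_gt, if_false, ← EReal.coe_sub]
      exact EReal.coe_le_coe_iff.2 (by linarith [mul_le_mul_log_add_exp hs τ])
  · refine le_iSup_of_le (Real.exp (τ - 1)) ?_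
    simp only [entIntegrand, (Real.exp_pos (τ - 1)).not_gt, if_false, ← EReal.coe_sub,
      Real.log_exp]
    exact EReal.coe_le_coe_iff.2 (by linarith)

section Exponential

variable {Ω : Type*} [MeasurableSpace Ω] {μ : Measure Ω} {X : Ω → ℝ}

lemma lmgf_eq_cgf (hX : Measurable X) (θ : ℝ) : lmgf μ X θ = ProbabilityTheory.cgf X μ θ := by
  rw [lmgf, ProbabilityTheory.cgf, ProbabilityTheory.mgf, integral_eq_lintegral_of_nonneg_ae]
  · exact Eventually.of_forall fun r => (Real.exp_pos _).le
  · exact (hX.const_mul θ).exp.aestronglyMeasurable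

lemma integrable_exp_of_lintegral_ne_top (hX : Measurable X) {θ : ℝ}
    (h : ∫⁻ r, ENNReal.ofReal (Real.exp (θ * X r)) ∂μ ≠ ⊤) :
    Integrable (fun r => Real.exp (θ * X r)) μ := by
  refine integrable_of_lintegral_ofReal_ne_top (hX.const_mul θ).exp h ?_
  have h0 : ∀ r, ENNReal.ofReal (-Real.exp (θ * X r)) = 0 := fun r =>
    ENNReal.ofReal_of_nonpos (neg_nonpos.2 (Real.exp_pos _).le)
  simp [h0]

lemma exp_lmgf [IsProbabilityMeasure μ] (hX : Measurable X) {θ : ℝ}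
    (h : Integrable (fun r => Real.exp (θ * X r)) μ) :
    Real.exp (lmgf μ X θ) = ∫ r, Real.exp (θ * X r) ∂μ := by
  rw [lmgf_eq_cgf hX, ProbabilityTheory.exp_cgf h, ProbabilityTheory.mgf]

lemma Kfun_entIntegrand_of_integrable [IsProbabilityMeasure μ] (hX : Measurable X) (θ₁ : ℝ)
    {θ₂ : ℝ} (h : Integrable (fun r => Real.exp (θ₂ * X r)) μ) :
    Kfun μ (fun _ : Ω => entIntegrand) X θ₁ θ₂ =
      ((Real.exp (θ₁ - 1 + lmgf μ X θ₂) : ℝ) : EReal) := by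
  have he : ∀ r, Real.exp (θ₁ + θ₂ * X r - 1) = Real.exp (θ₁ - 1) * Real.exp (θ₂ * X r) := by
    intro r
    rw [← Real.exp_add]
    ring_nf
  simp only [Kfun, conjβ_entIntegrand, he]
  rw [eInt_coe_of_integrable (h.const_mul _), integral_const_mul, ← exp_lmgf hX h, Real.exp_add]

lemma Kfun_entIntegrand_eq_top (hX : Measurable X) (θ₁ : ℝ) {θ₂ : ℝ}
    (h : ∫⁻ r, ENNReal.ofReal (Real.exp (θ₂ * X r)) ∂μ = ⊤) :
    Kfun μ (fun _ : Ω => entIntegrand) X θ₁ θ₂ = ⊤ := by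
  have he : ∀ r, ENNReal.ofReal (Real.exp (θ₁ + θ₂ * X r - 1)) =
      ENNReal.ofReal (Real.exp (θ₁ - 1)) * ENNReal.ofReal (Real.exp (θ₂ * X r)) := by
    intro r
    rw [← ENNReal.ofReal_mul (Real.exp_pos _).le, ← Real.exp_add]
    ring_nf
  simp only [Kfun, conjβ_entIntegrand]
  rw [eInt_coe_of_nonneg fun r => (Real.exp_pos _).le]
  simp only [he]
  rw [lintegral_const_mul _ (hX.const_mul θ₂).exp.ennreal_ofReal, h,
    ENNReal.mul_top (by simpa using Real.exp_pos _), EReal.coe_ennreal_top]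

lemma integrable_exp_sub_lmgf {θ : ℝ} (h : Integrable (fun r => Real.exp (θ * X r)) μ) :
    Integrable (fun r => Real.exp (θ * X r - lmgf μ X θ)) μ := by
  simp only [Real.exp_sub]
  exact h.div_const _

lemma integral_exp_sub_lmgf [IsProbabilityMeasure μ] (hX : Measurable X) {θ : ℝ}
    (h : Integrable (fun r => Real.exp (θ * X r)) μ) :
    ∫ r, Real.exp (θ * X r - lmgf μ X θ) ∂μ = 1 := by
  simp only [Real.exp_sub]
  rw [integral_div, ← exp_lmgf hX h, div_self (Real.exp_pos _).ne']

end Exponential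

section Density

variable {Ω : Type*} [MeasurableSpace Ω] {μ : Measure Ω} {X p q : Ω → ℝ}

lemma isDensity_of_integral_eq_one (hm : Measurable p) (h0 : ∀ r, 0 ≤ p r)
    (hi : Integrable p μ) (h1 : ∫ r, p r ∂μ = 1) : IsDensity μ p := by
  refine ⟨hm, h0, ?_⟩
  rw [← ofReal_integral_eq_lintegral_ofReal hi (Eventually.of_forall h0), h1, ENNReal.ofReal_one]

lemma IsDensity.integrable (hp : IsDensity μ p) : Integrable p μ := by
  refine integrable_of_lintegral_ofReal_ne_top hp.1 (by simp [hp.2.2]) ?_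
  have h0 : ∀ r, ENNReal.ofReal (-p r) = 0 := fun r =>
    ENNReal.ofReal_of_nonpos (neg_nonpos.2 (hp.2.1 r))
  simp [h0]

lemma IsDensity.integral_eq_one (hp : IsDensity μ p) : ∫ r, p r ∂μ = 1 := by
  rw [integral_eq_lintegral_of_nonneg_ae (Eventually.of_forall hp.2.1)
    hp.1.aestronglyMeasurable, hp.2.2, ENNReal.toReal_one]

lemma Hfun_entIntegrand (hp : ∀ r, 0 ≤ p r) :
    Hfun μ (fun _ : Ω => entIntegrand) p =
      eInt μ (fun r => ((p r * Real.log (p r) : ℝ) : EReal)) := by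
  simp only [Hfun, entIntegrand, (hp _).not_gt, if_false]

/-- A density with finite relative entropy and finite expected payoff. -/
def IsFiniteEntropyDensity (μ : Measure Ω) (X p : Ω → ℝ) : Prop :=
  IsDensity μ p ∧ Integrable (fun r => p r * Real.log (p r)) μ ∧
    Integrable (fun r => X r * p r) μ

lemma IsFiniteEntropyDensity.Hfun_eq (hp : IsFiniteEntropyDensity μ X p) :
    Hfun μ (fun _ : Ω => entIntegrand) p =
      ((∫ r, p r * Real.log (p r) ∂μ : ℝ) : EReal) := by
  rw [Hfun_entIntegrand hp.1.2.1, eInt_coe_of_integrable hp.2.1]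

lemma IsFiniteEntropyDensity.xInt_eq (hp : IsFiniteEntropyDensity μ X p) :
    xInt μ X p = ((∫ r, X r * p r ∂μ : ℝ) : EReal) := by
  rw [xInt, eInt_coe_of_integrable hp.2.2]

lemma IsFiniteEntropyDensity.mix [IsProbabilityMeasure μ]
    (hp : IsFiniteEntropyDensity μ X p) (hq : IsFiniteEntropyDensity μ X q) {t : ℝ}
    (ht0 : 0 ≤ t) (ht1 : t ≤ 1) :
    ∃ s, IsFiniteEntropyDensity μ X s ∧
      ∫ r, X r * s r ∂μ = (1 - t) * (∫ r, X r * p r ∂μ) + t * (∫ r, X r * q r ∂μ) ∧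
      ∫ r, s r * Real.log (s r) ∂μ ≤
        (1 - t) * (∫ r, p r * Real.log (p r) ∂μ) + t * (∫ r, q r * Real.log (q r) ∂μ) := by
  obtain ⟨hpd, hph, hpx⟩ := hp
  obtain ⟨hqd, hqh, hqx⟩ := hq
  have ht1' : 0 ≤ 1 - t := by linarith
  set s : Ω → ℝ := fun r => (1 - t) * p r + t * q r with hs
  have hs0 : ∀ r, 0 ≤ s r := fun r =>
    add_nonneg (mul_nonneg ht1' (hpd.2.1 r)) (mul_nonneg ht0 (hqd.2.1 r))
  have hsm : Measurable s := (hpd.1.const_mul _).add (hqd.1.const_mul _)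
  have hsd : IsDensity μ s := by
    refine isDensity_of_integral_eq_one hsm hs0
      ((hpd.integrable.const_mul _).add (hqd.integrable.const_mul _)) ?_
    rw [integral_add (hpd.integrable.const_mul _) (hqd.integrable.const_mul _),
      integral_const_mul, integral_const_mul, hpd.integral_eq_one, hqd.integral_eq_one]
    ring
  have hconv : ∀ r, s r * Real.log (s r) ≤
      (1 - t) * (p r * Real.log (p r)) + t * (q r * Real.log (q r)) := fun r => by
    have := Real.convexOn_mul_log.2 (Set.mem_Ici.2 (hpd.2.1 r)) (Set.mem_Ici.2 (hqd.2.1 r))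
      ht1' ht0 (by ring)
    simpa only [smul_eq_mul] using this
  have hbound : Integrable
      (fun r => (1 - t) * (p r * Real.log (p r)) + t * (q r * Real.log (q r))) μ :=
    (hph.const_mul _).add (hqh.const_mul _)
  have hsh : Integrable (fun r => s r * Real.log (s r)) μ := by
    refine (hbound.abs.add (integrable_const 1)).mono'
      (hsm.mul hsm.log).aestronglyMeasurable (Eventually.of_forall fun r => ?_)
    rw [Real.norm_eq_abs, abs_le]
    have h₁ := neg_one_le_mul_log (hs0 r)
    have h₂ := hconv r
    have h₃ := le_abs_self ((1 - t) * (p r * Real.log (p r)) + t * (q r * Real.log (q r)))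
    have h₄ := abs_nonneg ((1 - t) * (p r * Real.log (p r)) + t * (q r * Real.log (q r)))
    simp only [Pi.add_apply]
    constructor <;> linarith
  have hx : (fun r => X r * s r) = fun r => (1 - t) * (X r * p r) + t * (X r * q r) := by
    funext r
    simp only [hs]
    ring
  refine ⟨s, ⟨hsd, hsh, ?_⟩, ?_, ?_⟩
  · rw [hx]
    exact (hpx.const_mul _).add (hqx.const_mul _)
  · rw [hx, integral_add (hpx.const_mul _) (hqx.const_mul _), integral_const_mul,
      integral_const_mul]
  · calc ∫ r, s r * Real.log (s r) ∂μ
        ≤ ∫ r, ((1 - t) * (p r * Real.log (p r)) + t * (q r * Real.log (q r))) ∂μ :=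
          integral_mono hsh hbound hconv
      _ = _ := by
          rw [integral_add (hph.const_mul _) (hqh.const_mul _), integral_const_mul,
            integral_const_mul]

lemma isFiniteEntropyDensity_one [IsProbabilityMeasure μ] (hX : Integrable X μ) :
    IsFiniteEntropyDensity μ X (fun _ => (1 : ℝ)) :=
  ⟨isDensity_of_integral_eq_one measurable_const (fun _ => zero_le_one)
    (integrable_const _) (by simp), by simp, by simpa using hX⟩

lemma exists_isFiniteEntropyDensity_integral_le [IsProbabilityMeasure μ] (hXm : Measurable X)
    (hX : Integrable X μ) {b : ℝ} (hb : essInfX μ X < (b : EReal)) :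
    ∃ p, IsFiniteEntropyDensity μ X p ∧ ∫ r, X r * p r ∂μ ≤ b := by
  set A : Set Ω := {r | X r < b} with hA_def
  have hA : MeasurableSet A := measurableSet_lt hXm measurable_const
  have hpos : 0 < μ.real A := by
    refine ENNReal.toReal_pos (fun h0 => hb.not_ge ?_) (measure_ne_top _ _)
    refine le_essInf_of_ae_le _ ?_
    filter_upwards [measure_eq_zero_iff_ae_notMem.1 h0] with r hr
    exact EReal.coe_le_coe_iff.2 (not_lt.1 hr)
  set c : ℝ := (μ.real A)⁻¹ with hc_def
  have hc : 0 < c := inv_pos.2 hpos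
  set p : Ω → ℝ := A.indicator fun _ => c with hp_def
  have hlog : (fun r => p r * Real.log (p r)) = A.indicator fun _ => c * Real.log c := by
    funext r
    by_cases hr : r ∈ A <;> simp [hp_def, hr]
  have hxp : (fun r => X r * p r) = A.indicator fun r => X r * c := by
    funext r
    by_cases hr : r ∈ A <;> simp [hp_def, hr]
  have hi : Integrable p μ := (integrable_const c).indicator hA
  have hone : ∫ r, p r ∂μ = 1 := by
    rw [integral_indicator hA, setIntegral_const, smul_eq_mul, hc_def, mul_inv_cancel₀ hpos.ne']
  have hxi : Integrable (fun r => X r * p r) μ := by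
    rw [hxp]
    exact (hX.mul_const c).indicator hA
  refine ⟨p, ⟨isDensity_of_integral_eq_one (measurable_const.indicator hA)
    (fun r => indicator_nonneg (fun _ _ => hc.le) r) hi hone, ?_, hxi⟩, ?_⟩
  · rw [hlog]
    exact (integrable_const _).indicator hA
  · calc ∫ r, X r * p r ∂μ ≤ ∫ r, b * p r ∂μ := by
          refine integral_mono hxi (hi.const_mul b) fun r => ?_
          by_cases hr : r ∈ A
          · simpa [hp_def, hr] using mul_le_mul_of_nonneg_right (le_of_lt hr) hc.le
          · simp [hp_def, hr]
      _ = b := by rw [integral_const_mul, hone, mul_one]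

lemma exists_truncated_exponential_density [IsProbabilityMeasure μ] (hXm : Measurable X)
    (θ n : ℝ) (hZ : 0 < ∫ r in {r | |X r| ≤ n}, Real.exp (θ * X r) ∂μ) :
    ∃ p, IsFiniteEntropyDensity μ X p ∧
      θ * (∫ r, X r * p r ∂μ) - ∫ r, p r * Real.log (p r) ∂μ =
        Real.log (∫ r in {r | |X r| ≤ n}, Real.exp (θ * X r) ∂μ) := by
  set A : Set Ω := {r | |X r| ≤ n} with hA_def
  have hA : MeasurableSet A := measurableSet_le hXm.abs measurable_const
  set Z : ℝ := ∫ r in A, Real.exp (θ * X r) ∂μ with hZ_def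
  set p : Ω → ℝ := A.indicator fun r => Real.exp (θ * X r - Real.log Z) with hp_def
  have hpm : Measurable p := ((hXm.const_mul θ).sub_const _).exp.indicator hA
  have hp0 : ∀ r, 0 ≤ p r := fun r => indicator_nonneg (fun _ _ => (Real.exp_pos _).le) r
  have hpi : Integrable p μ := by
    refine Integrable.of_bound hpm.aestronglyMeasurable (Real.exp (|θ| * n - Real.log Z))
      (Eventually.of_forall fun r => ?_)
    rw [Real.norm_of_nonneg (hp0 r)]
    by_cases hr : r ∈ A
    · simp only [hp_def, indicator_of_mem hr]
      refine Real.exp_le_exp.2 (sub_le_sub_right ?_ _)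
      calc θ * X r ≤ |θ * X r| := le_abs_self _
        _ = |θ| * |X r| := abs_mul _ _
        _ ≤ |θ| * n := mul_le_mul_of_nonneg_left hr (abs_nonneg _)
    · simp only [hp_def, indicator_of_notMem hr]
      exact (Real.exp_pos _).le
  have hone : ∫ r, p r ∂μ = 1 := by
    simp only [hp_def, Real.exp_sub, Real.exp_log hZ]
    rw [integral_indicator hA, integral_div, ← hZ_def, div_self hZ.ne']
  have hxi : Integrable (fun r => X r * p r) μ := by
    refine (hpi.const_mul n).mono' (hXm.mul hpm).aestronglyMeasurable
      (Eventually.of_forall fun r => ?_)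
    rw [norm_mul, Real.norm_of_nonneg (hp0 r), Real.norm_eq_abs]
    by_cases hr : r ∈ A
    · exact mul_le_mul_of_nonneg_right hr (hp0 r)
    · simp [hp_def, hr]
  have hlog : (fun r => p r * Real.log (p r)) =
      fun r => θ * (X r * p r) - Real.log Z * p r := by
    funext r
    by_cases hr : r ∈ A
    · simp only [hp_def, indicator_of_mem hr, Real.log_exp]
      ring
    · simp [hp_def, hr]
  refine ⟨p, ⟨isDensity_of_integral_eq_one hpm hp0 hpi hone, ?_, hxi⟩, ?_⟩
  · rw [hlog]
    exact (hxi.const_mul θ).sub (hpi.const_mul _)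
  · rw [hlog, integral_sub (hxi.const_mul θ) (hpi.const_mul _), integral_const_mul,
      integral_const_mul, hone]
    ring

lemma integrable_exp_and_lmgf_le [IsProbabilityMeasure μ] (hXm : Measurable X) {θ c : ℝ}
    (h : ∀ p, IsFiniteEntropyDensity μ X p →
      θ * (∫ r, X r * p r ∂μ) - ∫ r, p r * Real.log (p r) ∂μ ≤ c) :
    Integrable (fun r => Real.exp (θ * X r)) μ ∧ lmgf μ X θ ≤ c := by
  have hcover : AECover μ atTop fun n : ℕ => {r | |X r| ≤ (n : ℝ)} := by
    refine ⟨Eventually.of_forall fun r => ?_, fun n => measurableSet_le hXm.abs measurable_const⟩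
    obtain ⟨N, hN⟩ := exists_nat_ge |X r|
    filter_upwards [eventually_ge_atTop N] with n hn
    exact hN.trans (by exact_mod_cast hn)
  have hle : ∀ n : ℕ, ∫ r in {r | |X r| ≤ (n : ℝ)}, Real.exp (θ * X r) ∂μ ≤ Real.exp c := by
    intro n
    rcases le_or_gt (∫ r in {r | |X r| ≤ (n : ℝ)}, Real.exp (θ * X r) ∂μ) 0 with hZ | hZ
    · exact hZ.trans (Real.exp_pos _).le
    · obtain ⟨p, hp, hpe⟩ := exists_truncated_exponential_density hXm θ n hZ
      exact (Real.log_le_iff_le_exp hZ).1 (hpe ▸ h p hp)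
  have hint : Integrable (fun r => Real.exp (θ * X r)) μ := by
    refine hcover.integrable_of_integral_bounded_of_nonneg_ae (Real.exp c) (fun n => ?_)
      (Eventually.of_forall fun r => (Real.exp_pos _).le) (Eventually.of_forall hle)
    refine Measure.integrableOn_of_bounded (M := Real.exp (|θ| * n)) (measure_ne_top _ _)
      (hXm.const_mul θ).exp.aestronglyMeasurable ?_
    refine (ae_restrict_iff' (measurableSet_le hXm.abs measurable_const)).2
      (Eventually.of_forall fun r hr => ?_)
    rw [Real.norm_of_nonneg (Real.exp_pos _).le]
    refine Real.exp_le_exp.2 ?_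
    calc θ * X r ≤ |θ * X r| := le_abs_self _
      _ = |θ| * |X r| := abs_mul _ _
      _ ≤ |θ| * n := mul_le_mul_of_nonneg_left hr (abs_nonneg _)
  refine ⟨hint, ?_⟩
  rw [← Real.exp_le_exp, exp_lmgf hXm hint]
  exact le_of_tendsto (hcover.integral_tendsto_of_countably_generated hint)
    (Eventually.of_forall hle)

/-- Weak duality. -/
lemma div_lmgf_le_Vfun [IsProbabilityMeasure μ] (hXm : Measurable X) (k : ℝ) {θ : ℝ}
    (hθ : θ < 0) (hint : Integrable (fun r => Real.exp (θ * X r)) μ) :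
    (((k + lmgf μ X θ) / θ : ℝ) : EReal) ≤ Vfun μ (fun _ : Ω => entIntegrand) X k := by
  refine le_iInf fun ⟨p, hp, hH⟩ => ?_
  have hlogm : Measurable fun r => p r * Real.log (p r) := hp.1.mul hp.1.log
  rw [Hfun_entIntegrand hp.2.1] at hH
  have hlog : Integrable (fun r => p r * Real.log (p r)) μ := by
    refine (integrable_or_eInt_coe_eq_top hlogm (integrable_const (-1 : ℝ))
      fun r => neg_one_le_mul_log (hp.2.1 r)).resolve_right fun htop => ?_
    rw [htop] at hH
    exact (EReal.coe_lt_top k).not_ge hH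
  rw [eInt_coe_of_integrable hlog, EReal.coe_le_coe_iff] at hH
  set c := lmgf μ X θ
  have hexp : Integrable (fun r => Real.exp (θ * X r - c)) μ := integrable_exp_sub_lmgf hint
  have hsum : Integrable (fun r => p r * Real.log (p r) + Real.exp (θ * X r - c)) μ :=
    hlog.add hexp
  have hw : Integrable
      (fun r => (p r * Real.log (p r) + Real.exp (θ * X r - c) + (c - 1) * p r) / θ) μ :=
    (hsum.add (hp.integrable.const_mul (c - 1))).div_const θ
  have hval : ∫ r, (p r * Real.log (p r) + Real.exp (θ * X r - c) + (c - 1) * p r) / θ ∂μ =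
      ((∫ r, p r * Real.log (p r) ∂μ) + c) / θ := by
    rw [integral_div, integral_add hsum (hp.integrable.const_mul (c - 1)),
      integral_add hlog hexp, integral_const_mul, integral_exp_sub_lmgf hXm hint,
      hp.integral_eq_one]
    ring
  refine le_trans ?_ (coe_integral_le_eInt_coe (hXm.mul hp.1) hw fun r => ?_)
  · rw [hval]
    exact EReal.coe_le_coe_iff.2 (div_le_div_of_nonpos_of_le hθ.le (by linarith))
  · have := mul_le_mul_log_add_exp (hp.2.1 r) (θ * X r - c + 1)
    rw [add_sub_cancel_right] at this
    rw [div_le_iff_of_neg hθ]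
    linarith

end Density

/-- Existence of a Lagrange multiplier under a Slater condition. -/
lemma exists_lagrange_multiplier {ι : Type*} {S : Set ι} {x h : ι → ℝ} {k v : ℝ}
    (hmix : ∀ a ∈ S, ∀ b ∈ S, ∀ t : ℝ, 0 ≤ t → t ≤ 1 →
      ∃ c ∈ S, x c = (1 - t) * x a + t * x b ∧ h c ≤ (1 - t) * h a + t * h b)
    (hslater : ∃ q ∈ S, h q < k) (hv : ∀ q ∈ S, h q ≤ k → v ≤ x q) :
    ∃ l : ℝ, 0 ≤ l ∧ ∀ q ∈ S, v ≤ x q + l * (h q - k) := by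
  set T : Set ℝ := (fun q => (x q - v) / (k - h q)) '' {q ∈ S | h q < k} with hT
  have hne : T.Nonempty := by
    obtain ⟨q, hq, hqk⟩ := hslater
    exact ⟨_, q, ⟨hq, hqk⟩, rfl⟩
  have hlow : ∀ y ∈ T, 0 ≤ y := by
    rintro _ ⟨q, ⟨hq, hqk⟩, rfl⟩
    exact div_nonneg (sub_nonneg.2 (hv q hq hqk.le)) (sub_pos.2 hqk).le
  refine ⟨sInf T, le_csInf hne hlow, fun p hp => ?_⟩
  rcases lt_trichotomy (h p) k with hpk | hpk | hpk
  · have hle : sInf T ≤ (x p - v) / (k - h p) := csInf_le ⟨0, hlow⟩ ⟨p, ⟨hp, hpk⟩, rfl⟩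
    rw [le_div_iff₀ (sub_pos.2 hpk)] at hle
    linarith
  · simpa [hpk] using hv p hp hpk.le
  · have hle : (v - x p) / (h p - k) ≤ sInf T := by
      refine le_csInf hne ?_
      rintro _ ⟨q, ⟨hq, hqk⟩, rfl⟩
      have hd : 0 < h p - h q := by linarith
      obtain ⟨c, hc, hcx, hch⟩ := hmix q hq p hp ((k - h q) / (h p - h q))
        (div_nonneg (by linarith) hd.le) ((div_le_one hd).2 (by linarith))
      have hck : (1 - (k - h q) / (h p - h q)) * h q + (k - h q) / (h p - h q) * h p = k := by
        field_simp
        ring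
      have hvc := hv c hc (hch.trans hck.le)
      have hxc : (1 - (k - h q) / (h p - h q)) * x q + (k - h q) / (h p - h q) * x p =
          ((h p - k) * x q + (k - h q) * x p) / (h p - h q) := by
        field_simp
        ring
      rw [hcx, hxc, le_div_iff₀ hd] at hvc
      rw [div_le_div_iff₀ (sub_pos.2 hpk) (sub_pos.2 hqk)]
      linarith
    rw [div_le_iff₀ (sub_pos.2 hpk)] at hle
    linarith

section Duality

variable {Ω : Type*} [MeasurableSpace Ω] {μ : Measure Ω} {X : Ω → ℝ}

lemma Gfun_entIntegrand [IsProbabilityMeasure μ] (hXm : Measurable X) {θ : ℝ}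
    (hint : Integrable (fun r => Real.exp (θ * X r)) μ) :
    Gfun μ (fun _ : Ω => entIntegrand) X θ = ((lmgf μ X θ : ℝ) : EReal) := by
  simp only [Gfun, Kfun_entIntegrand_of_integrable hXm _ hint, ← EReal.coe_sub]
  refine le_antisymm (iInf_le_of_le (1 - lmgf μ X θ) ?_) (le_iInf fun θ₁ => ?_)
  · refine EReal.coe_le_coe_iff.2 ?_
    ring_nf
    simp
  · have := Real.add_one_le_exp (θ₁ - 1 + lmgf μ X θ)
    exact EReal.coe_le_coe_iff.2 (by linarith)

lemma exists_Vfun_eq_div_lmgf [IsProbabilityMeasure μ] (hXm : Measurable X)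
    (hX : Integrable X μ) {k : ℝ} (hk : 0 < k)
    (hkmax : (k : EReal) < kmax μ (fun _ : Ω => entIntegrand) X (∫ r, X r ∂μ)) :
    ∃ θ < 0, Integrable (fun r => Real.exp (θ * X r)) μ ∧
      Vfun μ (fun _ : Ω => entIntegrand) X k = (((k + lmgf μ X θ) / θ : ℝ) : EReal) := by
  obtain ⟨⟨b, hmb, hb⟩, hFb⟩ := lt_iSup_iff.1 hkmax
  have hone := isFiniteEntropyDensity_one (μ := μ) hX
  have hfeas : ∀ p, IsFiniteEntropyDensity μ X p → ∫ r, p r * Real.log (p r) ∂μ ≤ k →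
      b ≤ ∫ r, X r * p r ∂μ := by
    intro p hp hpk
    by_contra! hlt
    set x := ∫ r, X r * p r ∂μ
    set b₀ := ∫ r, X r ∂μ
    have hd : 0 < b₀ - x := by linarith
    have ht1 : (b₀ - b) / (b₀ - x) ≤ 1 := (div_le_one hd).2 (by linarith)
    have ht0 : 0 ≤ (b₀ - b) / (b₀ - x) := div_nonneg (by linarith) hd.le
    obtain ⟨s, hs, hsx, hsh⟩ := hone.mix hp ht0 ht1
    simp only [mul_one, Real.log_one, integral_zero, mul_zero, zero_add] at hsx hsh
    have hsb : ∫ r, X r * s r ∂μ = b := by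
      rw [hsx]
      change (1 - (b₀ - b) / (b₀ - x)) * b₀ + (b₀ - b) / (b₀ - x) * x = b
      field_simp
      ring
    have hsk : ∫ r, s r * Real.log (s r) ∂μ ≤ k :=
      hsh.trans ((mul_le_mul_of_nonneg_left hpk ht0).trans (mul_le_of_le_one_left hk.le ht1))
    refine hFb.not_ge (iInf_le_of_le ⟨s, hs.1, by rw [hs.xInt_eq, hsb]⟩ ?_)
    rw [hs.Hfun_eq]
    exact EReal.coe_le_coe_iff.2 hsk
  set T : Set ℝ := (fun p : Ω → ℝ => ∫ r, X r * p r ∂μ) ''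
    {p | IsFiniteEntropyDensity μ X p ∧ ∫ r, p r * Real.log (p r) ∂μ ≤ k} with hT
  have hTne : T.Nonempty := ⟨_, _, ⟨hone, by simpa using hk.le⟩, rfl⟩
  have hTb : ∀ y ∈ T, b ≤ y := by
    rintro _ ⟨p, ⟨hp, hpk⟩, rfl⟩
    exact hfeas p hp hpk
  have hVle : Vfun μ (fun _ : Ω => entIntegrand) X k ≤ ((sInf T : ℝ) : EReal) := by
    refine EReal.le_of_forall_lt_iff_le.1 fun y hy => ?_
    obtain ⟨_, ⟨p, ⟨hp, hpk⟩, rfl⟩, hpy⟩ :=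
      exists_lt_of_csInf_lt hTne (EReal.coe_lt_coe_iff.1 hy)
    refine iInf_le_of_le ⟨p, hp.1, ?_⟩ ?_
    · rw [hp.Hfun_eq]
      exact EReal.coe_le_coe_iff.2 hpk
    · rw [hp.xInt_eq]
      exact EReal.coe_le_coe_iff.2 hpy.le
  obtain ⟨l, hl0, hl⟩ := exists_lagrange_multiplier (S := {p | IsFiniteEntropyDensity μ X p})
    (x := fun p => ∫ r, X r * p r ∂μ) (h := fun p => ∫ r, p r * Real.log (p r) ∂μ)
    (k := k) (v := sInf T)
    (fun p hp q hq t ht0 ht1 => hp.mix hq ht0 ht1) ⟨_, hone, by simpa using hk⟩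
    (fun p hp hpk => csInf_le ⟨b, hTb⟩ ⟨p, ⟨hp, hpk⟩, rfl⟩)
  have hlpos : 0 < l := by
    refine hl0.lt_of_ne fun h0 => ?_
    obtain ⟨b', hmb', hb'⟩ := EReal.lt_iff_exists_real_btwn.1 hmb
    obtain ⟨p, hp, hpb⟩ := exists_isFiniteEntropyDensity_integral_le hXm hX hmb'
    have h₁ := hl p hp
    simp only [← h0, zero_mul, add_zero] at h₁
    have h₂ := le_csInf hTne hTb
    have h₃ := EReal.coe_lt_coe_iff.1 hb'
    linarith
  have hθ : -l⁻¹ < 0 := neg_lt_zero.2 (inv_pos.2 hlpos)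
  obtain ⟨hint, hle⟩ := integrable_exp_and_lmgf_le (θ := -l⁻¹) (c := -l⁻¹ * sInf T - k) hXm
    (fun p hp => by
      have h₁ := mul_le_mul_of_nonneg_left (hl p hp) (inv_pos.2 hlpos).le
      rw [mul_add, inv_mul_cancel_left₀ hlpos.ne'] at h₁
      linarith)
  refine ⟨-l⁻¹, hθ, hint, le_antisymm (hVle.trans ?_) (div_lmgf_le_Vfun hXm k hθ hint)⟩
  refine EReal.coe_le_coe_iff.2 ?_
  rw [le_div_iff_of_neg hθ]
  linarith

lemma IsWCLParam.integrable_exp [IsProbabilityMeasure μ] (hXm : Measurable X)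
    {k θ θ₁ θ₂ : ℝ} (hθ : θ < 0) (hint : Integrable (fun r => Real.exp (θ * X r)) μ)
    (h : IsWCLParam μ (fun _ : Ω => entIntegrand) X k θ₁ θ₂) :
    Integrable (fun r => Real.exp (θ₂ * X r)) μ := by
  refine integrable_exp_of_lintegral_ne_top hXm fun htop => ?_
  have hle := h.2 0 θ hθ
  rw [Kfun_entIntegrand_eq_top hXm θ₁ htop, Kfun_entIntegrand_of_integrable hXm 0 hint,
    EReal.coe_add_top, EReal.top_sub_coe, EReal.top_div_of_neg_ne_bot
      (by exact_mod_cast h.1) (EReal.coe_ne_bot _), ← EReal.coe_add, ← EReal.coe_sub,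
    ← EReal.coe_div] at hle
  exact EReal.coe_ne_bot _ (le_bot_iff.1 hle)

lemma IsWCLParam.eq_one_sub_lmgf [IsProbabilityMeasure μ] (hXm : Measurable X)
    {k θ₁ θ₂ : ℝ} (hint : Integrable (fun r => Real.exp (θ₂ * X r)) μ)
    (h : IsWCLParam μ (fun _ : Ω => entIntegrand) X k θ₁ θ₂) :
    θ₁ = 1 - lmgf μ X θ₂ := by
  have hle := h.2 (1 - lmgf μ X θ₂) θ₂ h.1
  rw [Kfun_entIntegrand_of_integrable hXm _ hint, Kfun_entIntegrand_of_integrable hXm _ hint]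
    at hle
  simp only [← EReal.coe_add, ← EReal.coe_sub, ← EReal.coe_div, EReal.coe_le_coe_iff] at hle
  rw [div_le_div_right_of_neg h.1, show 1 - lmgf μ X θ₂ - 1 + lmgf μ X θ₂ = 0 by ring,
    Real.exp_zero] at hle
  by_contra hne
  have := Real.add_one_lt_exp (x := θ₁ - 1 + lmgf μ X θ₂) fun h0 => hne (by linarith)
  linarith

end Duality

/-- the relative entropy case, Example of the paper. For
`θ₂ ∈ dom Λ` the infimum defining `G(θ₂)` is attained at `θ₁ = 1 − Λ(θ₂)` and
`G(θ₂) = Λ(θ₂)`; consequently `V(k) = max_{θ₂<0} (k + Λ(θ₂))/θ₂` for `k ∈ (0,k_max)`,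
and the worst case localiser is `q̂_k(r) = exp(θ₂ X(r) − Λ(θ₂))`, with `θ₂ < 0`
attaining this maximum; in particular `q̂_k` is a density. Here
`p_{θ₁,θ₂}(r) = (β*)'(θ₁ + θ₂ X(r)) = e^{θ₁ + θ₂ X(r) − 1}`. -/
theorem relative_entropy_case {Ω : Type*} [MeasurableSpace Ω] (μ : Measure Ω)
    (X : Ω → ℝ) (b₀ : ℝ)
    (hprob : IsProbabilityMeasure μ)
    (hst : Standing μ (fun _ : Ω => entIntegrand)
      (fun _ : Ω => fun s : ℝ => Real.log s + 1) X (fun _ : Ω => (1:ℝ)) b₀) :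
    -- `G = Λ` on `dom Λ`, with the infimum attained at `θ₁ = 1 − Λ(θ₂)`
    (∀ θ₂ : ℝ, (∫⁻ r, ENNReal.ofReal (Real.exp (θ₂ * X r)) ∂μ) ≠ ⊤ →
      (Kfun μ (fun _ : Ω => entIntegrand) X (1 - lmgf μ X θ₂) θ₂ -
          ((1 - lmgf μ X θ₂ : ℝ) : EReal) =
        Gfun μ (fun _ : Ω => entIntegrand) X θ₂) ∧
      Gfun μ (fun _ : Ω => entIntegrand) X θ₂ = ((lmgf μ X θ₂ : ℝ) : EReal)) ∧
    -- `V(k) = max_{θ₂<0} (k + Λ(θ₂))/θ₂`, and the worst case localiser is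
    -- `exp(θ₂ X − Λ(θ₂))`, a density
    (∀ k : ℝ, 0 < k →
      (k : EReal) < kmax (fun _ : Ω => entIntegrand) X b₀ (μ := μ) →
      (∃ θ₂ : ℝ, θ₂ < 0 ∧ (∫⁻ r, ENNReal.ofReal (Real.exp (θ₂ * X r)) ∂μ) ≠ ⊤ ∧
        Vfun μ (fun _ : Ω => entIntegrand) X k =
          (((k + lmgf μ X θ₂) / θ₂ : ℝ) : EReal) ∧
        (∀ θ₂' : ℝ, θ₂' < 0 →
          (∫⁻ r, ENNReal.ofReal (Real.exp (θ₂' * X r)) ∂μ) ≠ ⊤ →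
          (((k + lmgf μ X θ₂') / θ₂' : ℝ) : EReal) ≤
            Vfun μ (fun _ : Ω => entIntegrand) X k)) ∧
      (∀ θ₁ θ₂ : ℝ, IsWCLParam μ (fun _ : Ω => entIntegrand) X k θ₁ θ₂ →
        (∀ r : Ω,
          pFam (fun _ : Ω => fun τ : ℝ => Real.exp (τ - 1)) X θ₁ θ₂ r =
            Real.exp (θ₂ * X r - lmgf μ X θ₂)) ∧
        IsDensity μ (pFam (fun _ : Ω => fun τ : ℝ => Real.exp (τ - 1)) X θ₁ θ₂))) := by
  have hXm := hst.Xmeas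
  have hpay : eInt μ (fun r => (X r : EReal)) = (b₀ : EReal) := by
    simpa only [xInt, mul_one] using hst.payoff₀
  have hX : Integrable X μ := integrable_of_eInt_coe_eq_coe hXm hpay
  have hb₀ : b₀ = ∫ r, X r ∂μ :=
    EReal.coe_eq_coe_iff.1 (hpay.symm.trans (eInt_coe_of_integrable hX))
  refine ⟨fun θ₂ hfin => ?_, fun k hk hkmax => ?_⟩
  · have hint := integrable_exp_of_lintegral_ne_top hXm hfin
    refine ⟨?_, Gfun_entIntegrand hXm hint⟩
    rw [Gfun_entIntegrand hXm hint, Kfun_entIntegrand_of_integrable hXm _ hint, ← EReal.coe_sub]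
    ring_nf
    simp
  · rw [hb₀] at hkmax
    obtain ⟨θ, hθ, hint, hV⟩ := exists_Vfun_eq_div_lmgf hXm hX hk hkmax
    refine ⟨⟨θ, hθ, hint.lintegral_lt_top.ne, hV, fun θ' hθ' hfin =>
      div_lmgf_le_Vfun hXm k hθ' (integrable_exp_of_lintegral_ne_top hXm hfin)⟩,
      fun θ₁ θ₂ h => ?_⟩
    have hint₂ := h.integrable_exp hXm hθ hint
    have hp : ∀ r, pFam (fun _ : Ω => fun τ : ℝ => Real.exp (τ - 1)) X θ₁ θ₂ r =
        Real.exp (θ₂ * X r - lmgf μ X θ₂) := fun r => by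
      rw [pFam, h.eq_one_sub_lmgf hXm hint₂]
      ring_nf
    refine ⟨hp, ?_⟩
    rw [funext hp]
    exact isDensity_of_integral_eq_one ((hXm.const_mul θ₂).sub_const _).exp
      (fun r => (Real.exp_pos _).le) (integrable_exp_sub_lmgf hint₂)
      (integral_exp_sub_lmgf hXm hint₂)
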